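/- Let σ = 2 (constant), and let u, v be a real-valued classical solution of the Goldstein–Taylor system ∂ₜu + ∂ₓv = 0, ∂ₜv + ∂ₓu = −2v on 𝕋 × (0,∞) with initial data u₀, v₀, and set u_avg := (u₀)_avg. Then for every 0 < ε < 1 and all t ≥ 0, with θ_ε := 2(2−ε²)/(2+ε²): E_{θ_ε}(u(·,t) − u_avg, v(·,t)) ≤ E_{θ_ε}(u₀ − u_avg, v₀) · e^{−2(1−ε)t}. -/

import Mathlib

open MeasureTheory Real

/-- Average of a (2π-periodic) function over one period. -/
noncomputable def havg (h : ℝ → ℝ) : ℝ := (1 / (2 * π)) * ∫ x in (0:ℝ)..(2 * π), h x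

/-- Squared L²(𝕋) norm (normalized). -/
noncomputable def nsq (h : ℝ → ℝ) : ℝ := (1 / (2 * π)) * ∫ x in (0:ℝ)..(2 * π), (h x) ^ 2

/-- The anti-derivative ∂ₓ⁻¹ f with zero average. -/
noncomputable def antider (f : ℝ → ℝ) : ℝ → ℝ := fun x =>
  (∫ y in (0:ℝ)..x, f y) - havg (fun z => ∫ y in (0:ℝ)..z, f y)

/-- The entropy functional E_θ(f,g). -/
noncomputable def entropyE (θ : ℝ) (f g : ℝ → ℝ) : ℝ :=
  nsq f + nsq g - (θ / (2 * π)) * ∫ x in (0:ℝ)..(2 * π), antider f x * g x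

/-- **Wirtinger's inequality** for a function with zero mean over a period. -/
theorem integral_sq_le_integral_deriv_sq {w f : ℝ → ℝ} (hw : ∀ x, HasDerivAt w (f x) x)
    (hf : Continuous f) (hper : w (2 * π) = w 0) (hmean : ∫ x in (0:ℝ)..(2 * π), w x = 0) :
    ∫ x in (0:ℝ)..(2 * π), w x ^ 2 ≤ ∫ x in (0:ℝ)..(2 * π), f x ^ 2 := by
  have hab : (0:ℝ) < 2 * π := by positivity
  have hwc : Continuous w := continuous_iff_continuousAt.2 fun x => (hw x).continuousAt
  have hL2 : ∀ g : ℝ → ℝ, Continuous g →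
      MemLp (fun x => (g x : ℂ)) 2 (volume.restrict (Set.Ioc 0 (2 * π))) := by
    intro g hg
    have hgc : Continuous fun x => (g x : ℂ) := by fun_prop
    obtain ⟨C, hC⟩ := (isCompact_Icc (a := (0:ℝ)) (b := 2 * π)).exists_bound_of_continuousOn
      hgc.continuousOn
    exact MemLp.of_bound hgc.aestronglyMeasurable C
      ((ae_restrict_iff' measurableSet_Ioc).2 (.of_forall fun x hx => hC x ⟨hx.1.le, hx.2⟩))
  have hP : ∀ g : ℝ → ℝ, Continuous g →
      HasSum (fun n : ℤ => ‖fourierCoeffOn hab (fun x => (g x : ℂ)) n‖ ^ 2)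
        ((2 * π)⁻¹ * ∫ x in (0:ℝ)..(2 * π), g x ^ 2) := by
    intro g hg
    simpa using hasSum_sq_fourierCoeffOn hab (hL2 g hg)
  have hle : ∀ n : ℤ, ‖fourierCoeffOn hab (fun x => (w x : ℂ)) n‖ ^ 2 ≤
      ‖fourierCoeffOn hab (fun x => (f x : ℂ)) n‖ ^ 2 := by
    intro n
    rcases eq_or_ne n 0 with rfl | hn
    · have h0 : fourierCoeffOn hab (fun x => (w x : ℂ)) 0 = 0 := by
        rw [fourierCoeffOn_eq_integral]
        simp [intervalIntegral.integral_ofReal, hmean]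
      rw [h0]
      simp
    · have h1 := fourierCoeffOn_of_hasDerivAt hab hn (f := fun x => (w x : ℂ))
        (f' := fun x => (f x : ℂ)) (fun x _ => (hw x).ofReal_comp)
        ((Complex.continuous_ofReal.comp hf).intervalIntegrable _ _)
      rw [h1, hper]
      have hn1 : (1:ℝ) ≤ |(n:ℝ)| := by exact_mod_cast Int.one_le_abs hn
      gcongr
      simp only [sub_self, mul_zero, zero_sub, norm_mul, norm_neg, norm_div, norm_one,
        Complex.norm_I, Complex.ofReal_zero, sub_zero, Complex.norm_intCast, Complex.norm_real,
        Complex.ofReal_mul, Complex.ofReal_ofNat, Complex.norm_ofNat, Real.norm_eq_abs,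
        abs_of_pos Real.pi_pos, mul_one]
      rw [← mul_assoc]
      refine mul_le_of_le_one_left (norm_nonneg _) ?_
      rw [one_div, inv_mul_le_iff₀ (by positivity)]
      nlinarith [Real.pi_pos]
  have h := hasSum_le hle (hP w hwc) (hP f hf)
  exact le_of_mul_le_mul_left h (by positivity)

/-- Differentiation under the integral sign on the open half-line. -/
theorem hasDerivAt_intervalIntegral_of_continuousOn {F F' : ℝ → ℝ → ℝ} (a b : ℝ)
    (hF : ∀ t, Continuous (F t))
    (hF' : ContinuousOn (Function.uncurry F') (Set.Ioi 0 ×ˢ Set.univ))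
    (hd : ∀ t, 0 < t → ∀ x, HasDerivAt (fun s => F s x) (F' t x) t) {t : ℝ} (ht : 0 < t) :
    HasDerivAt (fun s => ∫ x in a..b, F s x) (∫ x in a..b, F' t x) t := by
  have hK : IsCompact (Set.Icc (t / 2) (2 * t) ×ˢ Set.uIcc a b) :=
    isCompact_Icc.prod isCompact_uIcc
  obtain ⟨C, hC⟩ := hK.exists_bound_of_continuousOn (hF'.mono (by
    rintro ⟨s, x⟩ ⟨hs, -⟩
    exact ⟨lt_of_lt_of_le (by positivity : 0 < t / 2) hs.1, trivial⟩))
  have hslice : Continuous (F' t) := by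
    have : ContinuousOn (fun x => Function.uncurry F' (t, x)) Set.univ :=
      hF'.comp (by fun_prop) fun x _ => ⟨ht, trivial⟩
    exact continuousOn_univ.1 this
  refine (intervalIntegral.hasDerivAt_integral_of_dominated_loc_of_deriv_le
    (s := Set.Icc (t / 2) (2 * t)) (bound := fun _ => C)
    (Icc_mem_nhds (by linarith) (by linarith))
    (.of_forall fun s => (hF s).aestronglyMeasurable) ((hF t).intervalIntegrable _ _)
    hslice.aestronglyMeasurable ?_ (by simp) ?_).2
  · exact .of_forall fun x hx s hs => hC (s, x) ⟨hs, Set.uIoc_subset_uIcc hx⟩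
  · exact .of_forall fun x _ s hs => hd s (lt_of_lt_of_le (by positivity : 0 < t / 2) hs.1) x

/-- A periodic solution of the Goldstein–Taylor system with `σ = 2` for positive times, continuous
in all of space-time, whose `x`-derivatives are `Ux` and `Vx`. -/
structure IsGTSolution (U V Ux Vx : ℝ → ℝ → ℝ) : Prop where
  continuous_fst : Continuous (Function.uncurry U)
  continuous_snd : Continuous (Function.uncurry V)
  continuousOn_fst : ContinuousOn (Function.uncurry Ux) (Set.Ioi 0 ×ˢ Set.univ)
  continuousOn_snd : ContinuousOn (Function.uncurry Vx) (Set.Ioi 0 ×ˢ Set.univ)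
  periodic_fst : ∀ t, U t (2 * π) = U t 0
  periodic_snd : ∀ t, V t (2 * π) = V t 0
  hasDerivAt_fst : ∀ t, 0 < t → ∀ x, HasDerivAt (U t) (Ux t x) x
  hasDerivAt_snd : ∀ t, 0 < t → ∀ x, HasDerivAt (V t) (Vx t x) x
  hasDerivAt_time_fst : ∀ t, 0 < t → ∀ x, HasDerivAt (fun s => U s x) (-Vx t x) t
  hasDerivAt_time_snd : ∀ t, 0 < t → ∀ x, HasDerivAt (fun s => V s x) (-Ux t x - 2 * V t x) t

namespace IsGTSolution

variable {U V Ux Vx : ℝ → ℝ → ℝ}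

theorem continuous_slice {G : ℝ → ℝ → ℝ} (h : Continuous (Function.uncurry G)) (t : ℝ) :
    Continuous (G t) :=
  h.comp (by fun_prop : Continuous fun x : ℝ => (t, x))

theorem continuous_slice_of_pos {G : ℝ → ℝ → ℝ}
    (h : ContinuousOn (Function.uncurry G) (Set.Ioi 0 ×ˢ Set.univ)) {t : ℝ} (ht : 0 < t) :
    Continuous (G t) := by
  have : ContinuousOn (fun x => Function.uncurry G (t, x)) Set.univ :=
    h.comp (by fun_prop) fun x _ => ⟨ht, trivial⟩
  exact continuousOn_univ.1 this

theorem continuous_integral {G : ℝ → ℝ → ℝ} (h : Continuous (Function.uncurry G)) (a b : ℝ) :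
    Continuous fun t => ∫ x in a..b, G t x :=
  intervalIntegral.continuous_parametric_intervalIntegral_of_continuous' h a b

theorem continuous_primitive {G : ℝ → ℝ → ℝ} (h : Continuous (Function.uncurry G)) :
    Continuous (Function.uncurry fun t x => ∫ y in (0:ℝ)..x, G t y) :=
  intervalIntegral.continuous_parametric_intervalIntegral_of_continuous
    (f := fun (p : ℝ × ℝ) y => G p.1 y)
    (h.comp (by fun_prop : Continuous fun q : (ℝ × ℝ) × ℝ => (q.1.1, q.2)))
    _root_.continuous_snd

theorem integral_deriv_snd (h : IsGTSolution U V Ux Vx) {t : ℝ} (ht : 0 < t) (x : ℝ) :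
    ∫ y in (0:ℝ)..x, Vx t y = V t x - V t 0 :=
  intervalIntegral.integral_eq_sub_of_hasDerivAt (fun y _ => h.hasDerivAt_snd t ht y)
    ((continuous_slice_of_pos h.continuousOn_snd ht).intervalIntegrable _ _)

theorem integral_deriv_fst (h : IsGTSolution U V Ux Vx) {t : ℝ} (ht : 0 < t) (x : ℝ) :
    ∫ y in (0:ℝ)..x, Ux t y = U t x - U t 0 :=
  intervalIntegral.integral_eq_sub_of_hasDerivAt (fun y _ => h.hasDerivAt_fst t ht y)
    ((continuous_slice_of_pos h.continuousOn_fst ht).intervalIntegrable _ _)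

theorem hasDerivAt_primitive (h : IsGTSolution U V Ux Vx) {t : ℝ} (ht : 0 < t) (x : ℝ) :
    HasDerivAt (fun s => ∫ y in (0:ℝ)..x, U s y) (V t 0 - V t x) t := by
  have := hasDerivAt_intervalIntegral_of_continuousOn (F' := fun t x => -Vx t x) 0 x
    (continuous_slice h.continuous_fst) h.continuousOn_snd.neg h.hasDerivAt_time_fst ht
  rwa [intervalIntegral.integral_neg, h.integral_deriv_snd ht, neg_sub] at this

/-- Conservation of mass. -/
theorem integral_fst_eq (h : IsGTSolution U V Ux Vx) {t : ℝ} (ht : 0 ≤ t) :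
    ∫ x in (0:ℝ)..(2 * π), U t x = ∫ x in (0:ℝ)..(2 * π), U 0 x := by
  rcases ht.eq_or_lt with rfl | ht'
  · rfl
  obtain ⟨c, hc, hslope⟩ := exists_hasDerivAt_eq_slope
    (fun s => ∫ x in (0:ℝ)..(2 * π), U s x) (fun _ => 0) ht'
    (continuous_integral h.continuous_fst 0 (2 * π)).continuousOn fun s hs => by
      have := hasDerivAt_intervalIntegral_of_continuousOn (F' := fun t x => -Vx t x) 0 (2 * π)
        (continuous_slice h.continuous_fst) h.continuousOn_snd.neg h.hasDerivAt_time_fst hs.1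
      rwa [intervalIntegral.integral_neg, h.integral_deriv_snd hs.1, h.periodic_snd, sub_self,
        neg_zero] at this
  rw [eq_comm, div_eq_zero_iff] at hslope
  rcases hslope with hslope | hslope <;> linarith

theorem hasDerivAt_integral_snd (h : IsGTSolution U V Ux Vx) {t : ℝ} (ht : 0 < t) :
    HasDerivAt (fun s => ∫ x in (0:ℝ)..(2 * π), V s x)
      (-2 * ∫ x in (0:ℝ)..(2 * π), V t x) t := by
  have hU := continuous_slice_of_pos h.continuousOn_fst ht
  have hV := continuous_slice h.continuous_snd t
  have := hasDerivAt_intervalIntegral_of_continuousOn (F' := fun t x => -Ux t x - 2 * V t x)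
    0 (2 * π) (continuous_slice h.continuous_snd)
    (h.continuousOn_fst.neg.sub (h.continuous_snd.const_mul 2).continuousOn)
    h.hasDerivAt_time_snd ht
  convert this using 1
  rw [intervalIntegral.integral_sub (Continuous.intervalIntegrable (by fun_prop) _ _)
    (Continuous.intervalIntegrable (by fun_prop) _ _), intervalIntegral.integral_neg,
    h.integral_deriv_fst ht, h.periodic_fst, intervalIntegral.integral_const_mul]
  ring

theorem hasDerivAt_integral_primitive (h : IsGTSolution U V Ux Vx) {t : ℝ} (ht : 0 < t) :
    HasDerivAt (fun s => ∫ x in (0:ℝ)..(2 * π), ∫ y in (0:ℝ)..x, U s y)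
      (2 * π * V t 0 - ∫ x in (0:ℝ)..(2 * π), V t x) t := by
  have hV := continuous_slice h.continuous_snd t
  have := hasDerivAt_intervalIntegral_of_continuousOn (F' := fun t x => V t 0 - V t x)
    0 (2 * π) (continuous_slice (continuous_primitive h.continuous_fst))
    (Continuous.continuousOn <| (h.continuous_snd.comp
      (by fun_prop : Continuous fun p : ℝ × ℝ => (p.1, (0:ℝ)))).sub h.continuous_snd)
    (fun t ht x => h.hasDerivAt_primitive ht x) ht
  convert this using 1
  rw [intervalIntegral.integral_sub (by simp) (hV.intervalIntegrable _ _)]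
  simp

theorem hasDerivAt_integral_sq_add_sq (h : IsGTSolution U V Ux Vx) {t : ℝ} (ht : 0 < t) :
    HasDerivAt (fun s => ∫ x in (0:ℝ)..(2 * π), (U s x ^ 2 + V s x ^ 2))
      (-4 * ∫ x in (0:ℝ)..(2 * π), V t x ^ 2) t := by
  have hU := continuous_slice h.continuous_fst t
  have hV := continuous_slice h.continuous_snd t
  have hUx := continuous_slice_of_pos h.continuousOn_fst ht
  have hVx := continuous_slice_of_pos h.continuousOn_snd ht
  have hflux : ∫ x in (0:ℝ)..(2 * π), (Ux t x * V t x + U t x * Vx t x) = 0 := by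
    rw [intervalIntegral.integral_deriv_mul_eq_sub (fun x _ => h.hasDerivAt_fst t ht x)
      (fun x _ => h.hasDerivAt_snd t ht x) (hUx.intervalIntegrable _ _)
      (hVx.intervalIntegrable _ _), h.periodic_fst, h.periodic_snd, sub_self]
  have hU' := h.continuous_fst.continuousOn (s := Set.Ioi 0 ×ˢ Set.univ)
  have hV' := h.continuous_snd.continuousOn (s := Set.Ioi 0 ×ˢ Set.univ)
  have := hasDerivAt_intervalIntegral_of_continuousOn
    (F := fun s x => U s x ^ 2 + V s x ^ 2)
    (F' := fun t x => -2 * (Ux t x * V t x + U t x * Vx t x) + -4 * V t x ^ 2)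
    0 (2 * π)
    (fun s => ((continuous_slice h.continuous_fst s).pow 2).add
      ((continuous_slice h.continuous_snd s).pow 2))
    (by
      simp only [Function.uncurry_def] at *
      exact (((h.continuousOn_fst.mul hV').add (hU'.mul h.continuousOn_snd)).const_mul (-2)).add
        ((hV'.pow 2).const_mul (-4)))
    (fun t ht x => by
      refine (((h.hasDerivAt_time_fst t ht x).pow 2).add
        ((h.hasDerivAt_time_snd t ht x).pow 2)).congr_deriv ?_
      push_cast
      ring) ht
  convert this using 1
  rw [intervalIntegral.integral_add (Continuous.intervalIntegrable (by fun_prop) _ _)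
    (Continuous.intervalIntegrable (by fun_prop) _ _),
    intervalIntegral.integral_const_mul, intervalIntegral.integral_const_mul, hflux]
  ring

theorem hasDerivAt_integral_primitive_mul (h : IsGTSolution U V Ux Vx) {t : ℝ} (ht : 0 < t)
    (hmean : ∫ x in (0:ℝ)..(2 * π), U t x = 0) :
    HasDerivAt (fun s => ∫ x in (0:ℝ)..(2 * π), (∫ y in (0:ℝ)..x, U s y) * V s x)
      (V t 0 * (∫ x in (0:ℝ)..(2 * π), V t x) - (∫ x in (0:ℝ)..(2 * π), V t x ^ 2)
        + (∫ x in (0:ℝ)..(2 * π), U t x ^ 2)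
        - 2 * ∫ x in (0:ℝ)..(2 * π), (∫ y in (0:ℝ)..x, U t y) * V t x) t := by
  have hU := continuous_slice h.continuous_fst t
  have hV := continuous_slice h.continuous_snd t
  have hUx := continuous_slice_of_pos h.continuousOn_fst ht
  have hWc := continuous_primitive h.continuous_fst
  have hW := continuous_slice hWc t
  have hparts : ∫ x in (0:ℝ)..(2 * π), (U t x * U t x + (∫ y in (0:ℝ)..x, U t y) * Ux t x) = 0 := by
    rw [intervalIntegral.integral_deriv_mul_eq_sub (u := fun x => ∫ y in (0:ℝ)..x, U t y)
      (fun x _ => (hU.integral_hasStrictDerivAt 0 x).hasDerivAt)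
      (fun x _ => h.hasDerivAt_fst t ht x) (hU.intervalIntegrable _ _)
      (hUx.intervalIntegrable _ _), hmean]
    simp
  have hV' := h.continuous_snd.continuousOn (s := Set.Ioi 0 ×ˢ Set.univ)
  have hU' := h.continuous_fst.continuousOn (s := Set.Ioi 0 ×ˢ Set.univ)
  have hW' := hWc.continuousOn (s := Set.Ioi 0 ×ˢ Set.univ)
  have hV0 : ContinuousOn (fun p : ℝ × ℝ => V p.1 0) (Set.Ioi 0 ×ˢ Set.univ) :=
    (h.continuous_snd.comp (by fun_prop : Continuous fun p : ℝ × ℝ => (p.1, (0:ℝ)))).continuousOn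
  have := hasDerivAt_intervalIntegral_of_continuousOn
    (F := fun s x => (∫ y in (0:ℝ)..x, U s y) * V s x)
    (F' := fun t x => (V t 0 * V t x - V t x ^ 2 + U t x ^ 2
      - 2 * ((∫ y in (0:ℝ)..x, U t y) * V t x))
      - (U t x * U t x + (∫ y in (0:ℝ)..x, U t y) * Ux t x))
    0 (2 * π)
    (fun s => (continuous_slice hWc s).mul (continuous_slice h.continuous_snd s))
    (by
      simp only [Function.uncurry_def] at *
      exact ((((hV0.mul hV').sub (hV'.pow 2)).add (hU'.pow 2)).sub
        ((hW'.mul hV').const_mul 2)).sub ((hU'.mul hU').add (hW'.mul h.continuousOn_fst)))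
    (fun t ht x => by
      refine ((h.hasDerivAt_primitive ht x).mul (h.hasDerivAt_time_snd t ht x)).congr_deriv ?_
      ring) ht
  convert this using 1
  have hi : ∀ g : ℝ → ℝ, Continuous g → IntervalIntegrable g volume 0 (2 * π) :=
    fun g hg => hg.intervalIntegrable _ _
  rw [intervalIntegral.integral_sub (hi _ (by fun_prop)) (hi _ (by fun_prop)), hparts, sub_zero,
    intervalIntegral.integral_sub (hi _ (by fun_prop)) (hi _ (by fun_prop)),
    intervalIntegral.integral_add (hi _ (by fun_prop)) (hi _ (by fun_prop)),
    intervalIntegral.integral_sub (hi _ (by fun_prop)) (hi _ (by fun_prop)),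
    intervalIntegral.integral_const_mul, intervalIntegral.integral_const_mul]

end IsGTSolution

/-- The mixed term of the entropy, up to the factor `2π`. -/
theorem integral_antider_mul {f g : ℝ → ℝ} (hf : Continuous f) (hg : Continuous g) :
    ∫ x in (0:ℝ)..(2 * π), antider f x * g x =
      (∫ x in (0:ℝ)..(2 * π), (∫ y in (0:ℝ)..x, f y) * g x) -
        (1 / (2 * π)) * (∫ x in (0:ℝ)..(2 * π), ∫ y in (0:ℝ)..x, f y) *
          ∫ x in (0:ℝ)..(2 * π), g x := by
  have hF : Continuous fun x => ∫ y in (0:ℝ)..x, f y :=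
    intervalIntegral.continuous_primitive (fun a b => hf.intervalIntegrable a b) 0
  simp only [antider, havg, sub_mul]
  rw [intervalIntegral.integral_sub (Continuous.intervalIntegrable (by fun_prop) _ _)
    (Continuous.intervalIntegrable (by fun_prop) _ _), intervalIntegral.integral_const_mul]

/-- Young's inequality combined with Wirtinger's inequality for the mixed term. -/
theorem integral_antider_mul_le {f g : ℝ → ℝ} (hf : Continuous f) (hg : Continuous g)
    (hmean : ∫ x in (0:ℝ)..(2 * π), f x = 0) {a b c : ℝ} (ha : 0 ≤ a)
    (habc : ∀ x y : ℝ, c * (x * y) ≤ a * x ^ 2 + b * y ^ 2) :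
    c * ∫ x in (0:ℝ)..(2 * π), antider f x * g x ≤
      a * (∫ x in (0:ℝ)..(2 * π), f x ^ 2) + b * ∫ x in (0:ℝ)..(2 * π), g x ^ 2 := by
  have hw : ∀ x, HasDerivAt (antider f) (f x) x := fun x =>
    (hf.integral_hasStrictDerivAt 0 x).hasDerivAt.sub_const _
  have hwc : Continuous (antider f) := continuous_iff_continuousAt.2 fun x => (hw x).continuousAt
  have hF : Continuous fun x => ∫ y in (0:ℝ)..x, f y :=
    intervalIntegral.continuous_primitive (fun a b => hf.intervalIntegrable a b) 0
  have hW := integral_sq_le_integral_deriv_sq hw hf (by simp [antider, hmean]) (by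
    simp only [antider]
    rw [intervalIntegral.integral_sub (hF.intervalIntegrable _ _) (by simp)]
    simp only [havg, intervalIntegral.integral_const, sub_zero, smul_eq_mul]
    field_simp
    ring)
  have hi : ∀ g : ℝ → ℝ, Continuous g → IntervalIntegrable g volume 0 (2 * π) :=
    fun g hg => hg.intervalIntegrable _ _
  calc c * ∫ x in (0:ℝ)..(2 * π), antider f x * g x
      = ∫ x in (0:ℝ)..(2 * π), c * (antider f x * g x) :=
        (intervalIntegral.integral_const_mul _ _).symm
    _ ≤ ∫ x in (0:ℝ)..(2 * π), (a * antider f x ^ 2 + b * g x ^ 2) :=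
        intervalIntegral.integral_mono_on (by positivity) (hi _ (by fun_prop)) (hi _ (by fun_prop))
          fun x _ => habc _ _
    _ = a * (∫ x in (0:ℝ)..(2 * π), antider f x ^ 2) + b * ∫ x in (0:ℝ)..(2 * π), g x ^ 2 := by
        rw [intervalIntegral.integral_add (hi _ (by fun_prop)) (hi _ (by fun_prop)),
          intervalIntegral.integral_const_mul, intervalIntegral.integral_const_mul]
    _ ≤ _ := by gcongr

namespace IsGTSolution

variable {U V Ux Vx : ℝ → ℝ → ℝ}

theorem two_pi_mul_entropyE (h : IsGTSolution U V Ux Vx) (θ t : ℝ) :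
    2 * π * entropyE θ (U t) (V t) = (∫ x in (0:ℝ)..(2 * π), (U t x ^ 2 + V t x ^ 2)) -
      θ * ((∫ x in (0:ℝ)..(2 * π), (∫ y in (0:ℝ)..x, U t y) * V t x) -
        (1 / (2 * π)) * ((∫ x in (0:ℝ)..(2 * π), ∫ y in (0:ℝ)..x, U t y) *
          ∫ x in (0:ℝ)..(2 * π), V t x)) := by
  have hU := continuous_slice h.continuous_fst t
  have hV := continuous_slice h.continuous_snd t
  rw [entropyE, integral_antider_mul hU hV, nsq, nsq, intervalIntegral.integral_add
    (Continuous.intervalIntegrable (by fun_prop) _ _)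
    (Continuous.intervalIntegrable (by fun_prop) _ _)]
  field_simp

theorem continuous_entropyE (h : IsGTSolution U V Ux Vx) (θ : ℝ) :
    Continuous fun t => 2 * π * entropyE θ (U t) (V t) := by
  simp_rw [h.two_pi_mul_entropyE]
  have hU := h.continuous_fst
  have hV := h.continuous_snd
  have hW := continuous_primitive hU
  have h1 := continuous_integral (G := fun t x => U t x ^ 2 + V t x ^ 2)
    (by simp only [Function.uncurry_def] at *; fun_prop) 0 (2 * π)
  have h2 := continuous_integral (G := fun t x => (∫ y in (0:ℝ)..x, U t y) * V t x)
    (hW.mul hV) 0 (2 * π)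
  have h3 := continuous_integral hW 0 (2 * π)
  have h4 := continuous_integral hV 0 (2 * π)
  exact h1.sub ((h2.sub ((h3.mul h4).const_mul _)).const_mul θ)

/-- Entropy dissipation. -/
theorem hasDerivAt_entropyE (h : IsGTSolution U V Ux Vx) (θ : ℝ) {t : ℝ} (ht : 0 < t)
    (hmean : ∫ x in (0:ℝ)..(2 * π), U t x = 0) :
    HasDerivAt (fun s => 2 * π * entropyE θ (U s) (V s))
      (-4 * (∫ x in (0:ℝ)..(2 * π), V t x ^ 2) -
        θ * ((∫ x in (0:ℝ)..(2 * π), U t x ^ 2) - (∫ x in (0:ℝ)..(2 * π), V t x ^ 2) +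
          (1 / (2 * π)) * (∫ x in (0:ℝ)..(2 * π), V t x) ^ 2 -
          2 * ∫ x in (0:ℝ)..(2 * π), antider (U t) x * V t x)) t := by
  simp_rw [h.two_pi_mul_entropyE]
  refine ((h.hasDerivAt_integral_sq_add_sq ht).sub
    (((h.hasDerivAt_integral_primitive_mul ht hmean).sub
      (((h.hasDerivAt_integral_primitive ht).mul
        (h.hasDerivAt_integral_snd ht)).const_mul (1 / (2 * π)))).const_mul θ)).congr_deriv ?_
  rw [integral_antider_mul (continuous_slice h.continuous_fst t)
    (continuous_slice h.continuous_snd t)]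
  field_simp
  ring

theorem entropyE_le (h : IsGTSolution U V Ux Vx)
    (hmean : ∫ x in (0:ℝ)..(2 * π), U 0 x = 0) {ε : ℝ} (hε : 0 < ε) (hε1 : ε < 1) {t : ℝ} (ht : 0 ≤ t) :
    entropyE (2 * (2 - ε ^ 2) / (2 + ε ^ 2)) (U t) (V t) ≤
      entropyE (2 * (2 - ε ^ 2) / (2 + ε ^ 2)) (U 0) (V 0) * Real.exp (-(2 * (1 - ε)) * t) := by
  set θ := 2 * (2 - ε ^ 2) / (2 + ε ^ 2) with hθ
  have hθδ : θ = 2 - 4 * ε ^ 2 / (2 + ε ^ 2) := by rw [hθ]; field_simp; ring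
  set δ := 4 * ε ^ 2 / (2 + ε ^ 2) with hδ
  have hδε : δ < 2 * ε := by
    rw [hδ, div_lt_iff₀ (by positivity)]
    nlinarith [mul_pos hε (show 0 < (ε - 1) ^ 2 + 1 by positivity)]
  have hδ0 : 0 ≤ δ := by positivity
  have hdisc : (ε * θ) ^ 2 ≤ (2 * ε - δ) * (2 * ε + δ) := by
    rw [← sub_nonneg]
    have : (2 * ε - δ) * (2 * ε + δ) - (ε * θ) ^ 2 = 16 * ε ^ 4 / (2 + ε ^ 2) ^ 2 := by
      rw [hθ, hδ]; field_simp; ring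
    rw [this]
    positivity
  have hquad : ∀ x y : ℝ,
      2 * ε * θ * (x * y) ≤ (2 * ε - δ) * x ^ 2 + (2 * ε + δ) * y ^ 2 := by
    intro x y
    have ha : 0 < 2 * ε - δ := by linarith
    refine le_of_mul_le_mul_left ?_ ha
    nlinarith [sq_nonneg ((2 * ε - δ) * x - ε * θ * y), mul_le_mul_of_nonneg_right hdisc
      (sq_nonneg y)]
  have hanti : AntitoneOn (fun s => 2 * π * entropyE θ (U s) (V s) * Real.exp (2 * (1 - ε) * s))
      (Set.Ici 0) := by
    refine antitoneOn_of_hasDerivWithinAt_nonpos (convex_Ici 0)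
      (Continuous.continuousOn ((h.continuous_entropyE θ).mul (by fun_prop)))
      (fun s hs => ?_) (fun s hs => ?_) (f' := fun s =>
        (-4 * (∫ x in (0:ℝ)..(2 * π), V s x ^ 2) -
        θ * ((∫ x in (0:ℝ)..(2 * π), U s x ^ 2) - (∫ x in (0:ℝ)..(2 * π), V s x ^ 2) +
          (1 / (2 * π)) * (∫ x in (0:ℝ)..(2 * π), V s x) ^ 2 -
          2 * ∫ x in (0:ℝ)..(2 * π), antider (U s) x * V s x) +
          2 * (1 - ε) * (2 * π * entropyE θ (U s) (V s))) * Real.exp (2 * (1 - ε) * s))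
    · rw [interior_Ici] at hs
      have hexp : HasDerivAt (fun s => Real.exp (2 * (1 - ε) * s))
          (Real.exp (2 * (1 - ε) * s) * (2 * (1 - ε))) s := by
        simpa using ((hasDerivAt_id s).const_mul (2 * (1 - ε))).exp
      refine HasDerivAt.hasDerivWithinAt ?_
      refine ((h.hasDerivAt_entropyE θ hs
        ((h.integral_fst_eq (le_of_lt hs)).trans hmean)).mul hexp).congr_deriv ?_
      ring
    · rw [interior_Ici] at hs
      refine mul_nonpos_of_nonpos_of_nonneg ?_ (Real.exp_pos _).le
      have hY := integral_antider_mul_le (continuous_slice h.continuous_fst s)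
        (continuous_slice h.continuous_snd s) ((h.integral_fst_eq (le_of_lt hs)).trans hmean)
        (by linarith : 0 ≤ 2 * ε - δ) hquad
      have hθ0 : 0 ≤ θ := div_nonneg (by nlinarith) (by positivity)
      have hE : 2 * π * entropyE θ (U s) (V s) = (∫ x in (0:ℝ)..(2 * π), U s x ^ 2) +
          (∫ x in (0:ℝ)..(2 * π), V s x ^ 2) -
          θ * ∫ x in (0:ℝ)..(2 * π), antider (U s) x * V s x := by
        rw [entropyE, nsq, nsq]
        field_simp
      have hV2 : 0 ≤ θ * ((1 / (2 * π)) * (∫ x in (0:ℝ)..(2 * π), V s x) ^ 2) := by positivity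
      rw [hE]
      generalize (∫ x in (0:ℝ)..(2 * π), V s x ^ 2) = B at *
      generalize (∫ x in (0:ℝ)..(2 * π), U s x ^ 2) = A at *
      generalize (∫ x in (0:ℝ)..(2 * π), antider (U s) x * V s x) = P at *
      have hAB : θ * (B - A) = (2 - δ) * (B - A) := by rw [hθδ]
      linarith
  have := hanti Set.self_mem_Ici ht ht
  simp only [mul_zero, Real.exp_zero, mul_one] at this
  rw [neg_mul, Real.exp_neg, ← div_eq_mul_inv, le_div_iff₀ (Real.exp_pos _)]
  rw [mul_assoc] at this
  exact le_of_mul_le_mul_left this (by positivity)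

end IsGTSolution

/-- Consequences of `C¹` regularity up to the initial time. -/
theorem regularity_of_contDiffOn {w : ℝ → ℝ → ℝ}
    (hw : ContDiffOn ℝ 1 (Function.uncurry w) (Set.Ici (0:ℝ) ×ˢ Set.univ)) :
    (Continuous (Function.uncurry fun t x => w (max t 0) x)) ∧
      (ContinuousOn (Function.uncurry fun t x => deriv (w t) x) (Set.Ioi 0 ×ˢ Set.univ)) ∧
      (∀ t, 0 < t → ∀ x, HasDerivAt (w t) (deriv (w t) x) x) ∧
      (∀ t, 0 < t → ∀ x, HasDerivAt (fun s => w (max s 0) x) (deriv (fun s => w s x) t) t) := by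
  have hopen : IsOpen (Set.Ioi (0:ℝ) ×ˢ (Set.univ : Set ℝ)) := isOpen_Ioi.prod isOpen_univ
  have hw' : ContDiffOn ℝ 1 (Function.uncurry w) (Set.Ioi (0:ℝ) ×ˢ Set.univ) :=
    hw.mono (Set.prod_mono Set.Ioi_subset_Ici_self le_rfl)
  have hd : ∀ t, 0 < t → ∀ x, DifferentiableAt ℝ (Function.uncurry w) (t, x) := fun t ht x =>
    (hw'.differentiableOn one_ne_zero).differentiableAt (hopen.mem_nhds ⟨ht, trivial⟩)
  have hx : ∀ t, 0 < t → ∀ x,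
      HasDerivAt (w t) (fderiv ℝ (Function.uncurry w) (t, x) (0, 1)) x := fun t ht x =>
    (hd t ht x).hasFDerivAt.comp_hasDerivAt x ((hasDerivAt_const x t).prodMk (hasDerivAt_id x))
  have ht' : ∀ t, 0 < t → ∀ x, DifferentiableAt ℝ (fun s => w s x) t := fun t ht x =>
    (hd t ht x).comp (f := fun s => (s, x)) t
      (differentiableAt_id.prodMk (differentiableAt_const x))
  refine ⟨?_, ?_, fun t ht x => (hx t ht x).differentiableAt.hasDerivAt, fun t ht x => ?_⟩
  · exact hw.continuousOn.comp_continuous (f := fun p : ℝ × ℝ => (max p.1 0, p.2)) (by fun_prop)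
      fun p => ⟨le_max_right p.1 0, trivial⟩
  · refine ((hw'.continuousOn_fderiv_of_isOpen hopen le_rfl).clm_apply
      (continuousOn_const (c := ((0:ℝ), (1:ℝ))))).congr fun p hp => (hx p.1 hp.1 p.2).deriv
  · refine (ht' t ht x).hasDerivAt.congr_of_eventuallyEq ?_
    filter_upwards [lt_mem_nhds ht] with s hs
    rw [max_eq_left hs.le]

/-- Theorem 1.1 (a), entropy decay for constant σ = 2 (defective case). -/
theorem gt_constant_entropy_decay_sigma_two
    (u v : ℝ → ℝ → ℝ) (u₀ v₀ : ℝ → ℝ)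
    (huC : ContDiffOn ℝ 1 (Function.uncurry u) (Set.Ici (0:ℝ) ×ˢ Set.univ))
    (hvC : ContDiffOn ℝ 1 (Function.uncurry v) (Set.Ici (0:ℝ) ×ˢ Set.univ))
    (hup : ∀ t, Function.Periodic (u t) (2 * π))
    (hvp : ∀ t, Function.Periodic (v t) (2 * π))
    (hpde1 : ∀ t, 0 < t → ∀ x, deriv (fun s => u s x) t + deriv (fun y => v t y) x = 0)
    (hpde2 : ∀ t, 0 < t → ∀ x,
      deriv (fun s => v s x) t + deriv (fun y => u t y) x = -2 * v t x)
    (hu0 : ∀ x, u 0 x = u₀ x) (hv0 : ∀ x, v 0 x = v₀ x) :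
    ∀ ε : ℝ, 0 < ε → ε < 1 → ∀ t, 0 ≤ t →
      entropyE (2 * (2 - ε ^ 2) / (2 + ε ^ 2)) (fun x => u t x - havg u₀) (v t) ≤
        entropyE (2 * (2 - ε ^ 2) / (2 + ε ^ 2)) (fun x => u₀ x - havg u₀) v₀ *
          Real.exp (-(2 * (1 - ε)) * t) := by
  intro ε hε hε1 t ht
  set m := havg u₀ with hm
  obtain ⟨hu1, hu2, hu3, hu4⟩ := regularity_of_contDiffOn huC
  obtain ⟨hv1, hv2, hv3, hv4⟩ := regularity_of_contDiffOn hvC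
  have hsol : IsGTSolution (fun t x => u (max t 0) x - m) (fun t x => v (max t 0) x)
      (fun t x => deriv (u t) x) (fun t x => deriv (v t) x) :=
    { continuous_fst := hu1.sub continuous_const
      continuous_snd := hv1
      continuousOn_fst := hu2
      continuousOn_snd := hv2
      periodic_fst := fun t => by simp [(hup _).eq]
      periodic_snd := fun t => (hvp _).eq
      hasDerivAt_fst := fun t ht x => by
        simpa [max_eq_left ht.le] using (hu3 t ht x).sub_const m
      hasDerivAt_snd := fun t ht x => by simpa [max_eq_left ht.le] using hv3 t ht x
      hasDerivAt_time_fst := fun t ht x => by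
        refine ((hu4 t ht x).sub_const m).congr_deriv ?_
        linarith [hpde1 t ht x]
      hasDerivAt_time_snd := fun t ht x => by
        refine (hv4 t ht x).congr_deriv ?_
        rw [max_eq_left ht.le]
        linarith [hpde2 t ht x] }
  have hu0' : u 0 = u₀ := funext hu0
  have hv0' : v 0 = v₀ := funext hv0
  have hu₀ : Continuous u₀ := by
    have := IsGTSolution.continuous_slice hu1 0
    simpa [hu0'] using this
  have hmean : ∫ x in (0:ℝ)..(2 * π), (u (max 0 0) x - m) = 0 := by
    rw [max_self, hu0', intervalIntegral.integral_sub (hu₀.intervalIntegrable _ _) (by simp)]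
    simp only [hm, havg, intervalIntegral.integral_const, smul_eq_mul]
    field_simp
    ring
  have := hsol.entropyE_le hmean hε hε1 ht
  simpa only [max_eq_left ht, max_self, hu0', hv0'] using this
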